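/- Let m ≥ 4 be an integer and 0 < a < 1. The map f(λ) := (a·λ^{m−1}, (1−a)·λ^{m−1}) maps 𝔻 into E(1/2,1/2) ⊆ ℂ² and is an m-geodesic of E(1/2,1/2), while the map φ(λ) := (f₁(λ)/λ², f₂(λ)/λ) = (a·λ^{m−3}, (1−a)·λ^{m−2}) is not an (m−1)-geodesic of E(1/2,1/2). -/

import Mathlib

open Complex Metric Set Filter

noncomputable section

/-- The open unit disc `𝔻` in `ℂ`. -/
def unitDisc : Set ℂ := Metric.ball (0 : ℂ) 1

/-- The Möbius function `m_α(λ) = (λ - α)/(1 - conj α · λ)`. -/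
def mobius (a z : ℂ) : ℂ := (z - a) / (1 - (starRingEnd ℂ) a * z)

/-- `B` agrees on the unit disc with a finite Blaschke product
`ζ · ∏_{j=1}^k m_{α_j}` of degree `k` (here `ζ ∈ 𝕋`, `α_j ∈ 𝔻`). -/
def IsBlaschkeOn (B : ℂ → ℂ) (k : ℕ) : Prop :=
  ∃ (ζ : ℂ) (α : Fin k → ℂ), ‖ζ‖ = 1 ∧ (∀ j, ‖α j‖ < 1) ∧
    ∀ z ∈ unitDisc, B z = ζ * ∏ j, mobius (α j) z

variable {E : Type*} [NormedAddCommGroup E] [NormedSpace ℂ E]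

/-- `f` is a weak `m`-extremal for the nodes `lam` with respect to the domain `D`:
there is no map `h`, holomorphic on an open neighborhood of the closed unit disc
with values in `D`, interpolating `f` at all the nodes. -/
def WeakExtremalFor (D : Set E) (f : ℂ → E) {m : ℕ} (lam : Fin m → ℂ) : Prop :=
  ¬ ∃ (U : Set ℂ) (h : ℂ → E), IsOpen U ∧ Metric.closedBall (0 : ℂ) 1 ⊆ U ∧
      DifferentiableOn ℂ h U ∧ Set.MapsTo h U D ∧ ∀ j, h (lam j) = f (lam j)

/-- `f` is a weak `m`-extremal of `D`: it is a weak `m`-extremal for some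
pairwise distinct nodes in the unit disc. -/
def IsWeakExtremal (D : Set E) (f : ℂ → E) (m : ℕ) : Prop :=
  ∃ lam : Fin m → ℂ, Function.Injective lam ∧ (∀ j, lam j ∈ unitDisc) ∧
    WeakExtremalFor D f lam

/-- `f` is an `m`-extremal of `D`: it is a weak `m`-extremal for every choice of
pairwise distinct nodes in the unit disc. -/
def IsExtremal (D : Set E) (f : ℂ → E) (m : ℕ) : Prop :=
  ∀ lam : Fin m → ℂ, Function.Injective lam → (∀ j, lam j ∈ unitDisc) →
    WeakExtremalFor D f lam

/-- `f` is an `m`-geodesic of `D`: there is a holomorphic `F : D → 𝔻` such that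
`F ∘ f` is a non-constant Blaschke product of degree at most `m - 1`. -/
def IsGeodesic (D : Set E) (f : ℂ → E) (m : ℕ) : Prop :=
  ∃ F : E → ℂ, DifferentiableOn ℂ F D ∧ Set.MapsTo F D unitDisc ∧
    ∃ k : ℕ, 1 ≤ k ∧ k ≤ m - 1 ∧ IsBlaschkeOn (fun z => F (f z)) k

/-- A domain `D ⊆ ℂⁿ` is `k`-balanced (quasi-balanced) if
`(λ^{k₁} z₁, …, λ^{k_n} z_n) ∈ D` for all `λ` in the closed unit disc, `z ∈ D`. -/
def QuasiBalanced {n : ℕ} (k : Fin n → ℕ) (D : Set (Fin n → ℂ)) : Prop :=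
  ∀ l : ℂ, ‖l‖ ≤ 1 → ∀ z ∈ D, (fun j => l ^ k j * z j) ∈ D

/-- The complex ellipsoid `E(p) = {z ∈ ℂⁿ : Σ_j |z_j|^{2 p_j} < 1}`. -/
def ellipsoid {n : ℕ} (p : Fin n → ℝ) : Set (Fin n → ℂ) :=
  {z | ∑ j, ‖z j‖ ^ (2 * p j) < 1}

/-- The Euclidean unit ball `𝔹_n ⊆ ℂⁿ`. -/
def euclideanBall (n : ℕ) : Set (Fin n → ℂ) :=
  {z | ∑ j, ‖z j‖ ^ 2 < 1}

open Polynomial in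
/-- If a polynomial is bounded by `K z * ‖z‖ ^ N` near the origin and `K` tends to `K₀`, then its
`N`-th coefficient is bounded by `K₀` and the lower ones vanish. -/
lemma coeff_of_norm_eval_le (N : ℕ) (T : ℂ[X]) (K : ℂ → ℝ) (K₀ : ℝ)
    (hK : Tendsto K (nhdsWithin 0 {0}ᶜ) (nhds K₀))
    (hT : ∀ᶠ z in nhdsWithin (0 : ℂ) {0}ᶜ, ‖T.eval z‖ ≤ K z * ‖z‖ ^ N) :
    (∀ j < N, T.coeff j = 0) ∧ ‖T.coeff N‖ ≤ K₀ := by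
  have hlim : ∀ P : ℂ[X], Tendsto (fun z : ℂ => ‖P.eval z‖) (nhdsWithin 0 {0}ᶜ)
      (nhds ‖P.coeff 0‖) := fun P => by
    rw [coeff_zero_eq_eval_zero]
    exact (P.continuous.norm.tendsto 0).mono_left nhdsWithin_le_nhds
  induction N generalizing T with
  | zero =>
    refine ⟨by simp, le_of_tendsto_of_tendsto (hlim T) hK ?_⟩
    filter_upwards [hT] with z hz
    simpa using hz
  | succ N ih =>
    have h0 : T.coeff 0 = 0 := by
      have hz : Tendsto (fun z : ℂ => K z * ‖z‖ ^ (N + 1)) (nhdsWithin 0 {0}ᶜ)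
          (nhds (K₀ * ‖(0 : ℂ)‖ ^ (N + 1))) :=
        hK.mul (((continuous_norm.pow (N + 1)).tendsto 0).mono_left nhdsWithin_le_nhds)
      have := le_of_tendsto_of_tendsto (hlim T) hz hT
      simpa using this
    obtain ⟨T', rfl⟩ := X_dvd_iff.2 h0
    obtain ⟨h1, h2⟩ := ih T' (by
      filter_upwards [hT, self_mem_nhdsWithin] with z hz hne
      have hpos : 0 < ‖z‖ := norm_pos_iff.2 hne
      rw [eval_mul, eval_X, norm_mul, pow_succ] at hz
      refine le_of_mul_le_mul_left ?_ hpos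
      linarith)
    refine ⟨fun j hj => ?_, by rwa [coeff_X_mul]⟩
    cases j with
    | zero => exact h0
    | succ j => rw [coeff_X_mul]; exact h1 j (by omega)

lemma mem_unitDisc {z : ℂ} : z ∈ unitDisc ↔ ‖z‖ < 1 := by
  simp [unitDisc]

lemma one_sub_conj_mul_ne_zero {b z : ℂ} (hb : ‖b‖ < 1) (hz : ‖z‖ < 1) :
    1 - (starRingEnd ℂ) b * z ≠ 0 := by
  intro h
  have h1 : ‖(starRingEnd ℂ) b * z‖ = 1 := by
    rw [← sub_eq_zero.1 h, norm_one]
  rw [norm_mul, RCLike.norm_conj] at h1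
  nlinarith [norm_nonneg b, norm_nonneg z]

lemma norm_mobius_lt_one {b z : ℂ} (hb : ‖b‖ < 1) (hz : ‖z‖ < 1) : ‖mobius b z‖ < 1 := by
  have hne := one_sub_conj_mul_ne_zero hb hz
  rw [mobius, norm_div, div_lt_one (norm_pos_iff.2 hne)]
  refine lt_of_pow_lt_pow_left₀ 2 (norm_nonneg _) ?_
  have hb2 : ‖b‖ ^ 2 < 1 := by nlinarith [norm_nonneg b]
  have hz2 : ‖z‖ ^ 2 < 1 := by nlinarith [norm_nonneg z]
  rw [Complex.sq_norm, Complex.normSq_apply] at hb2 hz2 ⊢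
  rw [Complex.sq_norm, Complex.normSq_apply]
  simp only [sub_re, sub_im, mul_re, mul_im, conj_re, conj_im, one_re, one_im]
  nlinarith [mul_pos (sub_pos.2 hb2) (sub_pos.2 hz2)]

lemma differentiableOn_mobius_comp {V : Type*} [NormedAddCommGroup V] [NormedSpace ℂ V]
    {b : ℂ} (hb : ‖b‖ < 1) {h : V → ℂ} {s : Set V}
    (hh : DifferentiableOn ℂ h s) (hm : ∀ y ∈ s, ‖h y‖ < 1) :
    DifferentiableOn ℂ (fun y => mobius b (h y)) s := by
  have hd : DifferentiableOn ℂ (mobius b) {w | ‖w‖ < 1} := by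
    unfold mobius
    exact DifferentiableOn.fun_div (by fun_prop) (by fun_prop)
      fun w hw => one_sub_conj_mul_ne_zero hb hw
  exact hd.comp hh hm

/-- The Schwarz–Pick inequality at the centre of a disc. -/
lemma schwarz_pick {r : ℝ} {h : ℂ → ℂ} (hd : DifferentiableOn ℂ h (ball 0 r))
    (hm : ∀ y ∈ ball (0 : ℂ) r, ‖h y‖ < 1) {y : ℂ} (hy : y ∈ ball (0 : ℂ) r) :
    ‖h y - h 0‖ ≤ ‖y‖ / r * ‖1 - (starRingEnd ℂ) (h 0) * h y‖ := by
  have hr : 0 < r := (norm_nonneg y).trans_lt (by simpa using hy)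
  have h0 := hm 0 (mem_ball_self hr)
  have hzero : mobius (h 0) (h 0) = 0 := by simp [mobius]
  have key := dist_le_div_mul_dist_of_mapsTo_ball (R₂ := 1)
    (differentiableOn_mobius_comp h0 hd hm) (fun w hw => by
      simpa [hzero] using (norm_mobius_lt_one h0 (hm w hw)).le) hy
  simp only [hzero, dist_zero_right] at key
  have hne := one_sub_conj_mul_ne_zero h0 (hm y hy)
  rw [mobius, norm_div, div_le_iff₀ (norm_pos_iff.2 hne)] at key
  calc _ ≤ _ := key
    _ = _ := by ring

lemma schwarz_pick_of_le_one {h : ℂ → ℂ} (hd : DifferentiableOn ℂ h (ball 0 1))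
    (hm : ∀ y ∈ ball (0 : ℂ) 1, ‖h y‖ ≤ 1) {y : ℂ} (hy : y ∈ ball (0 : ℂ) 1) :
    ‖h y - h 0‖ ≤ ‖y‖ * ‖1 - (starRingEnd ℂ) (h 0) * h y‖ := by
  have hev : ∀ᶠ t : ℝ in nhdsWithin 1 (Iio 1), ‖(t : ℂ) * h y - t * h 0‖ ≤
      ‖y‖ * ‖1 - (starRingEnd ℂ) (t * h 0) * (t * h y)‖ := by
    filter_upwards [Ioo_mem_nhdsLT (zero_lt_one (α := ℝ))] with t ht
    have := schwarz_pick (r := 1) (h := fun w => (t : ℂ) * h w) (hd.const_mul _) (fun w hw => by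
      rw [norm_mul, norm_real, Real.norm_of_nonneg ht.1.le]
      nlinarith [hm w hw, ht.1, ht.2]) hy
    simpa using this
  have hl : ContinuousAt (fun t : ℝ => ‖(t : ℂ) * h y - t * h 0‖) 1 := by fun_prop
  have hr : ContinuousAt (fun t : ℝ =>
      ‖y‖ * ‖1 - (starRingEnd ℂ) (t * h 0) * (t * h y)‖) 1 := by
    simp only [map_mul, conj_ofReal]
    fun_prop
  have := le_of_tendsto_of_tendsto (hl.tendsto.mono_left nhdsWithin_le_nhds)
    (hr.tendsto.mono_left nhdsWithin_le_nhds) hev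
  simpa using this

lemma norm_deriv_zero_le {h : ℂ → ℂ} (hd : DifferentiableOn ℂ h (ball 0 1))
    (hm : ∀ y ∈ ball (0 : ℂ) 1, ‖h y‖ ≤ 1) : ‖deriv h 0‖ ≤ 1 - ‖h 0‖ ^ 2 := by
  have hnhds : ball (0 : ℂ) 1 ∈ nhds 0 := ball_mem_nhds _ one_pos
  have hda := hd.differentiableAt hnhds
  have hl : Tendsto (fun y => ‖slope h 0 y‖) (nhdsWithin 0 {0}ᶜ) (nhds ‖deriv h 0‖) :=
    hda.hasDerivAt.tendsto_slope.norm
  have hr : Tendsto (fun y => ‖1 - (starRingEnd ℂ) (h 0) * h y‖) (nhdsWithin 0 {0}ᶜ)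
      (nhds ‖1 - (starRingEnd ℂ) (h 0) * h 0‖) := by
    have : ContinuousAt (fun y => ‖1 - (starRingEnd ℂ) (h 0) * h y‖) 0 := by
      have := hda.continuousAt
      fun_prop
    exact this.tendsto.mono_left nhdsWithin_le_nhds
  have hle := le_of_tendsto_of_tendsto hl hr (by
    filter_upwards [self_mem_nhdsWithin, mem_nhdsWithin_of_mem_nhds hnhds] with y hne hy
    have hpos : 0 < ‖y‖ := norm_pos_iff.2 hne
    rw [slope_def_field, norm_div, sub_zero, div_le_iff₀ hpos, mul_comm]
    exact schwarz_pick_of_le_one hd hm hy)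
  have h0 := hm 0 (mem_ball_self one_pos)
  rw [Complex.conj_mul', ← ofReal_one, ← ofReal_pow, ← ofReal_sub, norm_real,
    Real.norm_of_nonneg (by nlinarith [norm_nonneg (h 0)])] at hle
  exact hle

/-- Second-order Taylor expansion of a self-map of the disc fixing the origin, with the sharp
bound on its coefficients. -/
lemma exists_taylor_two {g : ℂ → ℂ} (hd : DifferentiableOn ℂ g (ball 0 1))
    (hm : ∀ y ∈ ball (0 : ℂ) 1, ‖g y‖ < 1) (hg0 : g 0 = 0) :
    ∃ (c₁ c₂ : ℂ) (q : ℂ → ℂ), ‖c₁‖ ^ 2 + ‖c₂‖ ≤ 1 ∧ ContinuousAt q 0 ∧ q 0 = c₂ ∧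
      ∀ w, g w = c₁ * w + q w * w ^ 2 := by
  have hnhds : ball (0 : ℂ) 1 ∈ nhds 0 := ball_mem_nhds _ one_pos
  have hd1 : DifferentiableOn ℂ (dslope g 0) (ball 0 1) :=
    (differentiableOn_dslope hnhds).2 hd
  have hm1 : ∀ y ∈ ball (0 : ℂ) 1, ‖dslope g 0 y‖ ≤ 1 := fun y hy => by
    simpa using norm_dslope_le_div_of_mapsTo_ball (R₂ := 1) hd
      (fun w hw => by simpa [hg0] using (hm w hw).le) hy
  have hb := norm_deriv_zero_le hd1 hm1
  refine ⟨dslope g 0 0, deriv (dslope g 0) 0, dslope (dslope g 0) 0, by linarith,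
    continuousAt_dslope_same.2 (hd1.differentiableAt hnhds), dslope_same _ _, fun w => ?_⟩
  have e1 := sub_smul_dslope g 0 w
  have e2 := sub_smul_dslope (dslope g 0) 0 w
  simp only [sub_zero, smul_eq_mul, hg0] at e1 e2
  linear_combination -e1 - w * e2

open Polynomial in
lemma exists_polynomial_mul_of_linear_factor {N : ℕ} {P Q : ℂ[X]} (a : ℂ)
    (hP : P.natDegree ≤ N) (hQ : Q = reflect N (P.map (starRingEnd ℂ))) :
    (P * (X - C a)).natDegree ≤ N + 1 ∧
      Q * (1 - C ((starRingEnd ℂ) a) * X) =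
        reflect (N + 1) ((P * (X - C a)).map (starRingEnd ℂ)) := by
  have hdeg : ∀ b : ℂ, (X - C b).natDegree ≤ 1 := fun b => (natDegree_X_sub_C b).le
  refine ⟨natDegree_mul_le_of_le hP (hdeg a), ?_⟩
  rw [Polynomial.map_mul, Polynomial.map_sub, map_X, map_C,
    reflect_mul _ _ (natDegree_map_le.trans hP) (hdeg _), ← hQ, reflect_sub, reflect_C]
  have : reflect 1 (X : ℂ[X]) = 1 := by simp
  rw [this, pow_one]

open Polynomial in
/-- A Blaschke product of degree `k ≤ N` is a quotient `P / Q` with `deg P ≤ N` and `Q` the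
conjugate reflection of `P` in degree `N`. -/
lemma exists_polynomial_blaschke {k N : ℕ} (hk : k ≤ N) (α : Fin k → ℂ) (hα : ∀ j, ‖α j‖ < 1) :
    ∃ P Q : ℂ[X], P.natDegree ≤ N ∧ Q = reflect N (P.map (starRingEnd ℂ)) ∧ Q.eval 0 ≠ 0 ∧
      ∀ z ∈ unitDisc, P.eval z = Q.eval z * ∏ j, mobius (α j) z := by
  induction N, hk using Nat.le_induction with
  | base =>
    induction k with
    | zero =>
      exact ⟨1, 1, by simp, by simp, by simp, by simp⟩
    | succ k ih =>
      obtain ⟨P, Q, h1, h2, h3, h4⟩ := ih (fun j => α j.castSucc) fun j => hα _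
      obtain ⟨h1', h2'⟩ := exists_polynomial_mul_of_linear_factor (α (Fin.last k)) h1 h2
      refine ⟨_, _, h1', h2', by simpa using h3, fun z hz => ?_⟩
      have hne := one_sub_conj_mul_ne_zero (hα (Fin.last k)) (mem_unitDisc.1 hz)
      have e : (1 - (starRingEnd ℂ) (α (Fin.last k)) * z) * mobius (α (Fin.last k)) z =
          z - α (Fin.last k) := mul_div_cancel₀ _ hne
      rw [Fin.prod_univ_castSucc, eval_mul, h4 z hz]
      simp only [eval_mul, eval_sub, eval_X, eval_C, eval_one]
      linear_combination (-(Q.eval z * ∏ j : Fin k, mobius (α j.castSucc) z)) * e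
  | succ N _ ih =>
    obtain ⟨P, Q, h1, h2, h3, h4⟩ := ih
    obtain ⟨h1', h2'⟩ := exists_polynomial_mul_of_linear_factor (-1) h1 h2
    refine ⟨_, _, h1', h2', by simpa using h3, fun z hz => ?_⟩
    rw [eval_mul, h4 z hz]
    simp only [eval_mul, eval_sub, eval_X, eval_neg, eval_one, map_neg, map_one]
    ring

open Polynomial in
/-- If `B` is a Blaschke product of degree at most `N` with `B 0 = b`, then `mobius b ∘ B` is a
quotient `R / S` of polynomials which are conjugate reflections of each other, up to a unimodular
constant. -/
lemma IsBlaschkeOn.exists_polynomial {B : ℂ → ℂ} {k N : ℕ} (hB : IsBlaschkeOn B k) (hk : k ≤ N)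
    (hB1 : ∀ z ∈ unitDisc, ‖B z‖ < 1) :
    ∃ (ζ : ℂ) (R S : ℂ[X]), ‖ζ‖ = 1 ∧
      (∀ j ≤ N, S.coeff j = ζ * (starRingEnd ℂ) (R.coeff (N - j))) ∧ S.eval 0 ≠ 0 ∧
      ∀ z ∈ unitDisc, R.eval z = S.eval z * mobius (B 0) (B z) := by
  obtain ⟨ζ, α, hζ, hα, hBz⟩ := hB
  obtain ⟨P, Q, -, hQ, hQ0, hPQ⟩ := exists_polynomial_blaschke hk α hα
  have hPQ' : ∀ z ∈ unitDisc, ζ * P.eval z = Q.eval z * B z := fun z hz => by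
    rw [hPQ z hz, hBz z hz]; ring
  have h0 : (0 : ℂ) ∈ unitDisc := by simp [mem_unitDisc]
  have hζζ : ζ * (starRingEnd ℂ) ζ = 1 := by rw [Complex.mul_conj', hζ]; simp
  refine ⟨ζ, C ζ * P - C (B 0) * Q, Q - C ((starRingEnd ℂ) (B 0) * ζ) * P, hζ,
    fun j hj => ?_, ?_, fun z hz => ?_⟩
  · have h1 : ∀ i ≤ N, Q.coeff i = (starRingEnd ℂ) (P.coeff (N - i)) := fun i hi => by
      rw [hQ, coeff_reflect, revAt_le hi, coeff_map]
    rw [coeff_sub, coeff_sub, coeff_C_mul, coeff_C_mul, coeff_C_mul, map_sub, map_mul, map_mul]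
    rw [h1 j hj, h1 (N - j) (Nat.sub_le _ _), Nat.sub_sub_self hj, Complex.conj_conj]
    linear_combination (-(starRingEnd ℂ) (P.coeff (N - j))) * hζζ
  · have hne := one_sub_conj_mul_ne_zero (hB1 0 h0) (hB1 0 h0)
    have : (Q - C ((starRingEnd ℂ) (B 0) * ζ) * P).eval 0 =
        Q.eval 0 * (1 - (starRingEnd ℂ) (B 0) * B 0) := by
      simp only [eval_sub, eval_mul, eval_C]
      linear_combination (-(starRingEnd ℂ) (B 0)) * hPQ' 0 h0
    rw [this]
    exact mul_ne_zero hQ0 hne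
  · have hne := one_sub_conj_mul_ne_zero (hB1 0 h0) (hB1 z hz)
    have e := hPQ' z hz
    rw [mobius, ← mul_div_assoc, eq_div_iff hne]
    simp only [eval_sub, eval_mul, eval_C]
    linear_combination (1 - (starRingEnd ℂ) (B 0) * B z + (starRingEnd ℂ) (B 0) * (B z - B 0)) * e

/-- A holomorphic function from `{|x| + |y| < 1}` to the disc, compared with its restriction to
the first coordinate axis. -/
lemma norm_sub_le_of_mapsTo_unitDisc {G : (Fin 2 → ℂ) → ℂ}
    (hd : DifferentiableOn ℂ G {z | ‖z 0‖ + ‖z 1‖ < 1})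
    (hm : MapsTo G {z | ‖z 0‖ + ‖z 1‖ < 1} unitDisc) {x y : ℂ} (hxy : ‖x‖ + ‖y‖ < 1) :
    ‖G ![x, y] - G ![x, 0]‖ ≤ ‖y‖ / (1 - ‖x‖) * (1 + ‖G ![x, 0]‖) := by
  have hmaps : MapsTo (fun w : ℂ => ![x, w]) (ball 0 (1 - ‖x‖))
      {z : Fin 2 → ℂ | ‖z 0‖ + ‖z 1‖ < 1} := fun w hw => by
    have : ‖w‖ < 1 - ‖x‖ := by simpa using hw
    simp only [mem_ofPred_eq, Matrix.cons_val_zero, Matrix.cons_val_one]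
    linarith
  have hcurve : Differentiable ℂ fun w : ℂ => ![x, w] := differentiable_pi.2 fun i => by
    fin_cases i <;> simp
  have hy : y ∈ ball (0 : ℂ) (1 - ‖x‖) := by simp; linarith
  have hb : ∀ w ∈ ball (0 : ℂ) (1 - ‖x‖), ‖G ![x, w]‖ < 1 := fun w hw =>
    mem_unitDisc.1 (hm (hmaps hw))
  have h1x : 0 < 1 - ‖x‖ := by linarith [norm_nonneg y]
  refine (schwarz_pick (h := fun w => G ![x, w]) (hd.comp hcurve.differentiableOn hmaps)
    hb hy).trans ?_
  refine mul_le_mul_of_nonneg_left ?_ (by positivity)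
  refine (norm_sub_le _ _).trans ?_
  rw [norm_one, norm_mul, RCLike.norm_conj]
  nlinarith [hb y hy, norm_nonneg (G ![x, 0])]

lemma mem_of_monomial_curve {a : ℝ} (ha0 : 0 < a) (ha1 : a < 1) {i j : ℕ} (hi : i ≠ 0)
    (hj : j ≠ 0) {z : ℂ} (hz : ‖z‖ < 1) :
    ‖(a : ℂ) * z ^ i‖ + ‖(1 - (a : ℂ)) * z ^ j‖ < 1 := by
  have e1 : ‖(a : ℂ)‖ = a := by rw [norm_real, Real.norm_of_nonneg ha0.le]
  have e2 : ‖1 - (a : ℂ)‖ = 1 - a := by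
    rw [← ofReal_one, ← ofReal_sub, norm_real, Real.norm_of_nonneg (by linarith)]
  rw [norm_mul, norm_mul, norm_pow, norm_pow, e1, e2]
  have p1 := pow_lt_one₀ (norm_nonneg z) hz hi
  have p2 := pow_lt_one₀ (norm_nonneg z) hz hj
  nlinarith

open Polynomial in
/-- The curve `z ↦ (a z ^ n, (1 - a) z ^ (n + 1))` has no left inverse, up to Blaschke products of
degree at most `n + 1`. -/
lemma not_isGeodesic_monomial_curve {n : ℕ} (hn : 1 ≤ n) {a : ℝ} (ha0 : 0 < a) (ha1 : a < 1) :
    ¬ IsGeodesic {z : Fin 2 → ℂ | ‖z 0‖ + ‖z 1‖ < 1}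
      (fun z : ℂ => ![(a : ℂ) * z ^ n, (1 - (a : ℂ)) * z ^ (n + 1)]) (n + 2) := by
  rintro ⟨F, hFd, hFm, k, -, hk, hB⟩
  have e1 : ‖(a : ℂ)‖ = a := by rw [norm_real, Real.norm_of_nonneg ha0.le]
  have e2 : ‖1 - (a : ℂ)‖ = 1 - a := by
    rw [← ofReal_one, ← ofReal_sub, norm_real, Real.norm_of_nonneg (by linarith)]
  have hφ : ∀ z ∈ unitDisc, ‖F ![(a : ℂ) * z ^ n, (1 - (a : ℂ)) * z ^ (n + 1)]‖ < 1 :=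
    fun z hz => mem_unitDisc.1 (hFm (by
      simpa using mem_of_monomial_curve ha0 ha1 (by omega) (by omega) (mem_unitDisc.1 hz)))
  obtain ⟨ζ, R, S, hζ, hRS, hS0, hRSz⟩ := hB.exists_polynomial (N := n + 1) (by omega) hφ
  have hz0 : (0 : ℂ) ^ n = 0 := zero_pow (by omega)
  simp only [hz0, mul_zero, ne_eq, Nat.add_eq_zero_iff, one_ne_zero, and_false,
    not_false_eq_true, zero_pow] at hRSz
  set b := F ![0, 0] with hb_def
  have hb : ‖b‖ < 1 := mem_unitDisc.1 (hFm (by simp))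
  set G : (Fin 2 → ℂ) → ℂ := fun v => mobius b (F v) with hG
  have hGd : DifferentiableOn ℂ G {z | ‖z 0‖ + ‖z 1‖ < 1} :=
    differentiableOn_mobius_comp hb hFd fun v hv => mem_unitDisc.1 (hFm hv)
  have hGm : MapsTo G {z | ‖z 0‖ + ‖z 1‖ < 1} unitDisc := fun v hv =>
    mem_unitDisc.2 (norm_mobius_lt_one hb (mem_unitDisc.1 (hFm hv)))
  have hcurve : Differentiable ℂ fun w : ℂ => ![w, 0] := differentiable_pi.2 fun i => by
    fin_cases i <;> simp
  have hmaps : MapsTo (fun w : ℂ => ![w, 0]) (ball 0 1) {z : Fin 2 → ℂ | ‖z 0‖ + ‖z 1‖ < 1} :=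
    fun w hw => by simpa using hw
  have hgd : DifferentiableOn ℂ (fun w : ℂ => G ![w, 0]) (ball 0 1) :=
    hGd.comp hcurve.differentiableOn hmaps
  have hg0 : G ![0, 0] = 0 := by simp [hG, mobius, hb_def]
  obtain ⟨c₁, c₂, q, hc, hq, hq0, hgq⟩ := exists_taylor_two hgd
    (fun w hw => mem_unitDisc.1 (hGm (hmaps hw))) hg0
  set T : ℂ[X] := R - S * (C (c₁ * a) * X ^ n + C (c₂ * (a : ℂ) ^ 2) * X ^ (2 * n)) with hT
  set K : ℂ → ℝ := fun z => ‖S.eval z‖ * ((1 - a) / (1 - a * ‖z‖ ^ n) *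
    (1 + ‖G ![(a : ℂ) * z ^ n, 0]‖) + ‖q (a * z ^ n) - c₂‖ * a ^ 2) with hK
  have hKlim : Tendsto K (nhdsWithin 0 {0}ᶜ) (nhds (‖S.eval 0‖ * (1 - a))) := by
    have hinner : ContinuousAt (fun z : ℂ => (a : ℂ) * z ^ n) 0 := by fun_prop
    have hval : (a : ℂ) * (0 : ℂ) ^ n = 0 := by simp [hz0]
    have hc1 : ContinuousAt (fun z : ℂ => q (a * z ^ n)) 0 :=
      ContinuousAt.comp (f := fun z : ℂ => (a : ℂ) * z ^ n) (by rw [hval]; exact hq) hinner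
    have hc2 : ContinuousAt (fun z : ℂ => G ![(a : ℂ) * z ^ n, 0]) 0 :=
      ContinuousAt.comp (g := fun w : ℂ => G ![w, 0]) (f := fun z : ℂ => (a : ℂ) * z ^ n)
        (by rw [hval]; exact (hgd.differentiableAt (ball_mem_nhds _ one_pos)).continuousAt) hinner
    have hc3 : ContinuousAt (fun z : ℂ => S.eval z) 0 := S.continuous.continuousAt
    have hden : 1 - a * ‖(0 : ℂ)‖ ^ n ≠ 0 := by
      rw [norm_zero, zero_pow (by omega)]; simp
    have hKc : ContinuousAt K 0 := by
      have hc4 : ContinuousAt (fun z : ℂ => (1 - a) / (1 - a * ‖z‖ ^ n)) 0 :=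
        ContinuousAt.div (f := fun _ : ℂ => 1 - a) (g := fun z : ℂ => 1 - a * ‖z‖ ^ n)
          (by fun_prop) (by fun_prop) hden
      exact hc3.norm.mul ((hc4.mul (continuousAt_const.add hc2.norm)).add
        ((hc1.sub continuousAt_const).norm.mul continuousAt_const))
    have hK0 : K 0 = ‖S.eval 0‖ * (1 - a) := by
      have : (0 : ℝ) ^ n = 0 := zero_pow (by omega)
      simp [hK, hz0, hg0, hq0, this]
    rw [← hK0]
    exact hKc.tendsto.mono_left nhdsWithin_le_nhds
  have hTle : ∀ᶠ z in nhdsWithin (0 : ℂ) {0}ᶜ, ‖T.eval z‖ ≤ K z * ‖z‖ ^ (n + 1) := by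
    filter_upwards [mem_nhdsWithin_of_mem_nhds (ball_mem_nhds (0 : ℂ) one_pos)] with z hz
    have hz1 : ‖z‖ < 1 := by simpa using hz
    set w : ℂ := a * z ^ n with hw
    have hnw : ‖w‖ = a * ‖z‖ ^ n := by rw [hw, norm_mul, norm_pow, e1]
    have hsub := norm_sub_le_of_mapsTo_unitDisc hGd hGm
      (mem_of_monomial_curve ha0 ha1 (i := n) (j := n + 1) (by omega) (by omega) hz1)
    rw [← hw, norm_mul, e2, norm_pow, hnw] at hsub
    have hTz : T.eval z = S.eval z * ((G ![w, (1 - (a : ℂ)) * z ^ (n + 1)] - G ![w, 0]) +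
        (q w - c₂) * w ^ 2) := by
      rw [hT]
      simp only [eval_sub, eval_mul, eval_add, eval_pow, eval_C, eval_X]
      rw [hRSz z (mem_unitDisc.2 hz1), hgq w, hw, hG]
      ring
    rw [hTz, norm_mul, hK, mul_assoc]
    refine mul_le_mul_of_nonneg_left ((norm_add_le _ _).trans ?_) (norm_nonneg _)
    rw [add_mul]
    refine add_le_add (hsub.trans_eq (by ring)) ?_
    rw [norm_mul, norm_pow, hnw, mul_pow, ← pow_mul, mul_assoc]
    refine mul_le_mul_of_nonneg_left (mul_le_mul_of_nonneg_left ?_ (sq_nonneg a)) (norm_nonneg _)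
    exact pow_le_pow_of_le_one (norm_nonneg z) hz1.le (by omega)
  obtain ⟨hlow, htop⟩ := coeff_of_norm_eval_le (n + 1) T K _ hKlim hTle
  have hlow := hlow n (Nat.lt_succ_self n)
  rw [← coeff_zero_eq_eval_zero] at htop hS0
  have hs0 : S.coeff 0 = ζ * (starRingEnd ℂ) (R.coeff (n + 1)) := by
    simpa using hRS 0 (by omega)
  have hs1 : S.coeff 1 = ζ * (starRingEnd ℂ) (R.coeff n) := by
    simpa using hRS 1 (by omega)
  have ht : T = R - (S * C (c₁ * a)) * X ^ n - (S * C (c₂ * (a : ℂ) ^ 2)) * X ^ (2 * n) := by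
    rw [hT]; ring
  have n0 : ‖S.coeff 0‖ = ‖R.coeff (n + 1)‖ := by
    rw [hs0, norm_mul, hζ, one_mul, RCLike.norm_conj]
  have n1 : ‖S.coeff 1‖ = ‖R.coeff n‖ := by
    rw [hs1, norm_mul, hζ, one_mul, RCLike.norm_conj]
  have hlow' : R.coeff n = S.coeff 0 * (c₁ * a) := by
    rw [ht] at hlow
    simp only [coeff_sub, coeff_mul_X_pow', le_refl, if_true, Nat.sub_self, coeff_mul_C,
      if_neg (show ¬ 2 * n ≤ n by omega), sub_zero] at hlow
    exact sub_eq_zero.1 hlow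
  obtain ⟨ε, hε, htop'⟩ : ∃ ε : ℂ, ‖ε‖ ≤ ‖S.coeff 0‖ ∧ T.coeff (n + 1) =
      R.coeff (n + 1) - S.coeff 1 * (c₁ * a) - ε * (c₂ * (a : ℂ) ^ 2) := by
    rw [ht]
    simp only [coeff_sub, coeff_mul_X_pow', if_pos (Nat.le_succ n), Nat.add_sub_cancel_left,
      coeff_mul_C]
    split_ifs with h
    · refine ⟨S.coeff 0, le_rfl, ?_⟩
      rw [show n + 1 - 2 * n = 0 by omega]
    · exact ⟨0, by simp, by simp⟩
  have m1 : ‖R.coeff n‖ = ‖S.coeff 0‖ * (‖c₁‖ * a) := by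
    rw [hlow', norm_mul, norm_mul, e1]
  have hsum : R.coeff (n + 1) = T.coeff (n + 1) + S.coeff 1 * (c₁ * a) +
      ε * (c₂ * (a : ℂ) ^ 2) := by rw [htop']; ring
  have hfin : ‖S.coeff 0‖ ≤ ‖S.coeff 0‖ * (1 - a) + ‖S.coeff 0‖ * (‖c₁‖ * a) * (‖c₁‖ * a) +
      ‖S.coeff 0‖ * (‖c₂‖ * a ^ 2) := by
    calc ‖S.coeff 0‖ = ‖R.coeff (n + 1)‖ := n0
      _ ≤ ‖T.coeff (n + 1)‖ + ‖S.coeff 1‖ * (‖c₁‖ * a) + ‖ε‖ * (‖c₂‖ * a ^ 2) := by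
        rw [hsum]
        refine norm_add₃_le.trans_eq ?_
        simp only [norm_mul, norm_pow, e1]
      _ ≤ _ := by
        rw [n1, m1]
        gcongr
  have hpos : 0 < ‖S.coeff 0‖ := norm_pos_iff.2 hS0
  have hfin' : 1 ≤ (1 - a) + a ^ 2 * (‖c₁‖ ^ 2 + ‖c₂‖) :=
    le_of_mul_le_mul_left (by linarith) hpos
  nlinarith [mul_le_mul_of_nonneg_left hc (sq_nonneg a), mul_pos ha0 (sub_pos.2 ha1)]

/-- For `m ≥ 4` and `0 < a < 1`, the map
`f(λ) = (a λ^{m-1}, (1-a) λ^{m-1})` maps `𝔻` into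
`E(1/2,1/2) = {z ∈ ℂ² : |z₁| + |z₂| < 1}` and is an `m`-geodesic of it, while
`φ(λ) = (a λ^{m-3}, (1-a) λ^{m-2})` is not an `(m-1)`-geodesic of it. -/
theorem geodesic_with_quotient_not_geodesic_in_ellipsoid_half_half
    (m : ℕ) (hm : 4 ≤ m) (a : ℝ) (ha0 : 0 < a) (ha1 : a < 1)
    (Ehalf : Set (Fin 2 → ℂ)) (hE : Ehalf = {z | ‖z 0‖ + ‖z 1‖ < 1})
    (f : ℂ → Fin 2 → ℂ)
    (hf : f = fun z => ![(a : ℂ) * z ^ (m - 1), (1 - (a : ℂ)) * z ^ (m - 1)])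
    (φ : ℂ → Fin 2 → ℂ)
    (hφ : φ = fun z => ![(a : ℂ) * z ^ (m - 3), (1 - (a : ℂ)) * z ^ (m - 2)]) :
    Set.MapsTo f unitDisc Ehalf ∧ IsGeodesic Ehalf f m ∧
      ¬ IsGeodesic Ehalf φ (m - 1) := by
  subst hE hf hφ
  refine ⟨fun z hz => ?_, ⟨fun v => v 0 + v 1, ?_, fun v hv => ?_, m - 1, by omega, le_rfl, 1,
    fun _ => 0, by simp, by simp, fun z _ => ?_⟩, ?_⟩
  · simpa using mem_of_monomial_curve ha0 ha1 (i := m - 1) (j := m - 1) (by omega) (by omega)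
      (mem_unitDisc.1 hz)
  · fun_prop
  · exact mem_unitDisc.2 ((norm_add_le _ _).trans_lt hv)
  · simp [mobius]
    ring
  · obtain ⟨n, rfl⟩ : ∃ n, m = n + 3 := ⟨m - 3, by omega⟩
    exact not_isGeodesic_monomial_curve (n := n) (by omega) ha0 ha1
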